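/- (Bias decomposition with covariates.) Let (Ω, F, P) be a probability space. Let X assign to each cell (i,t) a covariate vector X_{it} ∈ ℝ^p, let β, δ ∈ ℝ^p, Γ ∈ ℝ^{N×K}, Λ ∈ ℝ^{T×K}, B ∈ ℝ^{K×K}, and E_⊥ ∈ ℝ^{N×T}. Let ε : Ω → ℝ^{N×T} and L̂ : Ω → ℝ^{N×T} be entrywise integrable random matrices with E[ε_{it}] = 0 for every cell (i,t), and suppose E[L̂] − L = Xδ + Γ B Λᵀ + E_⊥ entrywise, where L is the N×T matrix with entries L_{it} := X_{it}ᵀβ + (ΓΛᵀ)_{it} and Xδ is the N×T matrix with entries X_{it}ᵀδ. Set Y := L + ε. Then for fixed weights ω ∈ ℝ^{N₀} and θ ∈ ℝ^{T₀}, E[ τ̂_TROP(0;θ,ω) − Y_{NT} ] = Δ_u(ω,Γ)ᵀ B Δ_t(θ,Λ) − g(θ,ω)ᵀ δ − ⟨ E_⊥ , M(θ,ω) ⟩, where g(θ,ω) := Σ_{i,t} M(θ,ω)_{it} X_{it} ∈ ℝ^p. -/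

import Mathlib

open Finset Matrix MeasureTheory

noncomputable section

/-- Frobenius inner product of two `N × T` real matrices. -/
def frobInner {N T : ℕ} (A B : Matrix (Fin N) (Fin T) ℝ) : ℝ :=
  ∑ i, ∑ t, A i t * B i t

/-- The rank-one matrix `M(θ,ω) = (e_N − U_ω)(V_θ − e_T)ᵀ`. -/
def Mmat {N₀ T₀ : ℕ} (θ : Fin T₀ → ℝ) (ω : Fin N₀ → ℝ) :
    Matrix (Fin (N₀ + 1)) (Fin (T₀ + 1)) ℝ :=
  Matrix.of fun i t =>
    ((if i = Fin.last N₀ then (1 : ℝ) else 0) - (Fin.snoc ω (0 : ℝ) : Fin (N₀ + 1) → ℝ) i) *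
      ((Fin.snoc θ (0 : ℝ) : Fin (T₀ + 1) → ℝ) t - (if t = Fin.last T₀ then (1 : ℝ) else 0))

/-- The TROP counterfactual `τ̂_TROP(0; θ, ω)` for the treated cell `(N, T)`. -/
def tauTROP {N₀ T₀ : ℕ} (Y Lhat : Matrix (Fin (N₀ + 1)) (Fin (T₀ + 1)) ℝ)
    (θ : Fin T₀ → ℝ) (ω : Fin N₀ → ℝ) : ℝ :=
  Lhat (Fin.last N₀) (Fin.last T₀)
    + ∑ t : Fin T₀, θ t * (Y (Fin.last N₀) t.castSucc - Lhat (Fin.last N₀) t.castSucc)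
    + ∑ i : Fin N₀, ω i * (Y i.castSucc (Fin.last T₀) - Lhat i.castSucc (Fin.last T₀))
    - ∑ i : Fin N₀, ∑ t : Fin T₀,
        ω i * θ t * (Y i.castSucc t.castSucc - Lhat i.castSucc t.castSucc)

/-- Unit discrepancy `Δ_u(ω,Γ) := Σ_{i≤N₀} ω_i Γ_i − Γ_N ∈ ℝ^K`. -/
def unitDisc {N₀ K : ℕ} (ω : Fin N₀ → ℝ) (Γ : Matrix (Fin (N₀ + 1)) (Fin K) ℝ) :
    Fin K → ℝ :=
  fun k => (∑ i : Fin N₀, ω i * Γ i.castSucc k) - Γ (Fin.last N₀) k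

/-- Time discrepancy `Δ_t(θ,Λ) := Σ_{s≤T₀} θ_s Λ_s − Λ_T ∈ ℝ^K`. -/
def timeDisc {T₀ K : ℕ} (θ : Fin T₀ → ℝ) (Λ : Matrix (Fin (T₀ + 1)) (Fin K) ℝ) :
    Fin K → ℝ :=
  fun k => (∑ s : Fin T₀, θ s * Λ s.castSucc k) - Λ (Fin.last T₀) k

theorem Mmat_eq_vecMulVec {N₀ T₀ : ℕ} (θ : Fin T₀ → ℝ) (ω : Fin N₀ → ℝ) :
    Mmat θ ω = vecMulVec (Fin.snoc (-ω) 1) (Fin.snoc θ (-1)) := by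
  ext i t
  refine Fin.lastCases ?_ (fun i => ?_) i <;> refine Fin.lastCases ?_ (fun t => ?_) t <;>
    simp [Mmat, vecMulVec_apply, Fin.castSucc_ne_last]

theorem frobInner_vecMulVec {N T : ℕ} (A : Matrix (Fin N) (Fin T) ℝ)
    (a : Fin N → ℝ) (b : Fin T → ℝ) :
    frobInner A (vecMulVec a b) = a ⬝ᵥ A *ᵥ b := by
  simp only [frobInner, vecMulVec_apply, dotProduct, mulVec, Finset.mul_sum]
  exact Finset.sum_congr rfl fun _ _ => Finset.sum_congr rfl fun _ _ => by ring

theorem unitDisc_eq_neg_vecMul {N₀ K : ℕ} (ω : Fin N₀ → ℝ)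
    (Γ : Matrix (Fin (N₀ + 1)) (Fin K) ℝ) :
    unitDisc ω Γ = -((Fin.snoc (-ω) 1 : Fin (N₀ + 1) → ℝ) ᵥ* Γ) := by
  ext k
  simp [unitDisc, vecMul, dotProduct, Fin.sum_univ_castSucc]
  ring

theorem timeDisc_eq_mulVec {T₀ K : ℕ} (θ : Fin T₀ → ℝ)
    (Λ : Matrix (Fin (T₀ + 1)) (Fin K) ℝ) :
    timeDisc θ Λ = Λᵀ *ᵥ (Fin.snoc θ (-1) : Fin (T₀ + 1) → ℝ) := by
  ext k
  simp only [timeDisc, mulVec, dotProduct, transpose_apply, Fin.sum_univ_castSucc,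
    Fin.snoc_castSucc, Fin.snoc_last]
  simp only [mul_comm (θ _)]
  ring

theorem frobInner_mul_mul_transpose_Mmat {N₀ T₀ K : ℕ} (θ : Fin T₀ → ℝ) (ω : Fin N₀ → ℝ)
    (Γ : Matrix (Fin (N₀ + 1)) (Fin K) ℝ) (Λ : Matrix (Fin (T₀ + 1)) (Fin K) ℝ)
    (B : Matrix (Fin K) (Fin K) ℝ) :
    frobInner (Γ * B * Λᵀ) (Mmat θ ω) = -(unitDisc ω Γ ⬝ᵥ B *ᵥ timeDisc θ Λ) := by
  rw [Mmat_eq_vecMulVec, frobInner_vecMulVec, unitDisc_eq_neg_vecMul, timeDisc_eq_mulVec,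
    neg_dotProduct, neg_neg, ← mulVec_mulVec, ← mulVec_mulVec, dotProduct_mulVec]

theorem tauTROP_sub_eq_frobInner {N₀ T₀ : ℕ}
    (Y Lhat : Matrix (Fin (N₀ + 1)) (Fin (T₀ + 1)) ℝ) (θ : Fin T₀ → ℝ) (ω : Fin N₀ → ℝ) :
    tauTROP Y Lhat θ ω - Y (Fin.last N₀) (Fin.last T₀) = frobInner (Y - Lhat) (Mmat θ ω) := by
  rw [Mmat_eq_vecMulVec]
  simp only [tauTROP, frobInner, vecMulVec_apply, Fin.sum_univ_castSucc, Fin.snoc_castSucc,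
    Fin.snoc_last, Finset.sum_add_distrib, Matrix.sub_apply, Pi.neg_apply]
  have h₁ (i : Fin N₀) (t : Fin T₀) : (Y i.castSucc t.castSucc - Lhat i.castSucc t.castSucc) *
      (-ω i * θ t) = -(ω i * θ t * (Y i.castSucc t.castSucc - Lhat i.castSucc t.castSucc)) := by
    ring
  have h₂ (i : Fin N₀) : (Y i.castSucc (Fin.last T₀) - Lhat i.castSucc (Fin.last T₀)) *
      (-ω i * -1) = ω i * (Y i.castSucc (Fin.last T₀) - Lhat i.castSucc (Fin.last T₀)) := by
    ring
  have h₃ (t : Fin T₀) : (Y (Fin.last N₀) t.castSucc - Lhat (Fin.last N₀) t.castSucc) *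
      (1 * θ t) = θ t * (Y (Fin.last N₀) t.castSucc - Lhat (Fin.last N₀) t.castSucc) := by
    ring
  simp only [h₁, h₂, h₃, Finset.sum_neg_distrib]
  ring

theorem integral_frobInner {Ω : Type*} [MeasurableSpace Ω] {μ : Measure Ω} {N T : ℕ}
    {A : Ω → Matrix (Fin N) (Fin T) ℝ} (hA : ∀ i t, Integrable (fun w => A w i t) μ)
    (M : Matrix (Fin N) (Fin T) ℝ) :
    ∫ w, frobInner (A w) M ∂μ = frobInner (Matrix.of fun i t => ∫ w, A w i t ∂μ) M := by
  have hM (i t) : Integrable (fun w => A w i t * M i t) μ := (hA i t).mul_const _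
  have hrow (i) : Integrable (fun w => ∑ t, A w i t * M i t) μ :=
    integrable_finsetSum _ fun t _ => hM i t
  refine (integral_finsetSum _ fun i _ => hrow i).trans (Finset.sum_congr rfl fun i _ => ?_)
  refine (integral_finsetSum _ fun t _ => hM i t).trans (Finset.sum_congr rfl fun t _ => ?_)
  exact integral_mul_const _ _

theorem frobInner_add_left {N T : ℕ} (A B M : Matrix (Fin N) (Fin T) ℝ) :
    frobInner (A + B) M = frobInner A M + frobInner B M := by
  simp [frobInner, add_mul, Finset.sum_add_distrib]

theorem frobInner_neg_left {N T : ℕ} (A M : Matrix (Fin N) (Fin T) ℝ) :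
    frobInner (-A) M = -frobInner A M := by
  simp [frobInner]

theorem frobInner_dotProduct {N T p : ℕ} (X : Fin N → Fin T → Fin p → ℝ) (δ : Fin p → ℝ)
    (M : Matrix (Fin N) (Fin T) ℝ) :
    frobInner (Matrix.of fun i t => X i t ⬝ᵥ δ) M
      = (fun k => ∑ i, ∑ t, M i t * X i t k) ⬝ᵥ δ := by
  simp only [frobInner, Matrix.of_apply, dotProduct, Finset.sum_mul]
  rw [Finset.sum_comm]
  simp_rw [Finset.sum_comm (s := (Finset.univ : Finset (Fin p)))]
  rw [Finset.sum_comm]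
  exact Finset.sum_congr rfl fun _ _ => Finset.sum_congr rfl fun _ _ =>
    Finset.sum_congr rfl fun _ _ => by ring

/-- bias decomposition with covariates: with
`L_{it} = X_{it}ᵀβ + (ΓΛᵀ)_{it}`, `Y = L + ε`, `E[ε_{it}] = 0`, and
`E[L̂] − L = Xδ + Γ B Λᵀ + E_⊥` entrywise,
`E[ τ̂_TROP(0;θ,ω) − Y_{NT} ] = Δ_uᵀ B Δ_t − gᵀδ − ⟨E_⊥, M(θ,ω)⟩`,
where `g(θ,ω) = Σ_{i,t} M(θ,ω)_{it} X_{it}`. -/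
theorem tauTROP_bias_with_covariates
    {Ω : Type*} [MeasurableSpace Ω] (μ : Measure Ω) [IsProbabilityMeasure μ]
    (N₀ T₀ K p : ℕ) (hN : 1 ≤ N₀) (hT : 1 ≤ T₀) (hK : 1 ≤ K) (hp : 1 ≤ p)
    (X : Fin (N₀ + 1) → Fin (T₀ + 1) → Fin p → ℝ) (β δ : Fin p → ℝ)
    (Γ : Matrix (Fin (N₀ + 1)) (Fin K) ℝ) (Λ : Matrix (Fin (T₀ + 1)) (Fin K) ℝ)
    (B : Matrix (Fin K) (Fin K) ℝ)
    (Eperp : Matrix (Fin (N₀ + 1)) (Fin (T₀ + 1)) ℝ)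
    (ε Lhat : Ω → Matrix (Fin (N₀ + 1)) (Fin (T₀ + 1)) ℝ)
    (hεint : ∀ i t, Integrable (fun w => ε w i t) μ)
    (hεmean : ∀ i t, ∫ w, ε w i t ∂μ = 0)
    (hLint : ∀ i t, Integrable (fun w => Lhat w i t) μ)
    (L : Matrix (Fin (N₀ + 1)) (Fin (T₀ + 1)) ℝ)
    (hL : ∀ i t, L i t = X i t ⬝ᵥ β
      + ((Γ * Λ.transpose : Matrix (Fin (N₀ + 1)) (Fin (T₀ + 1)) ℝ)) i t)
    (hLhatMean : ∀ i t, (∫ w, Lhat w i t ∂μ) - L i t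
      = X i t ⬝ᵥ δ
        + ((Γ * B * Λ.transpose : Matrix (Fin (N₀ + 1)) (Fin (T₀ + 1)) ℝ)) i t
        + Eperp i t)
    (ω : Fin N₀ → ℝ) (θ : Fin T₀ → ℝ) :
    (∫ w, (tauTROP (L + ε w) (Lhat w) θ ω
        - (L + ε w) (Fin.last N₀) (Fin.last T₀)) ∂μ)
      = unitDisc ω Γ ⬝ᵥ B.mulVec (timeDisc θ Λ)
        - (fun k => ∑ i, ∑ t, Mmat θ ω i t * X i t k) ⬝ᵥ δ
        - frobInner Eperp (Mmat θ ω) := by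
  have hA (i t) : Integrable (fun w => (L + ε w - Lhat w) i t) μ :=
    ((integrable_const (L i t)).add (hεint i t)).sub (hLint i t)
  have hmean : (Matrix.of fun i t => ∫ w, (L + ε w - Lhat w) i t ∂μ)
      = -((Matrix.of fun i t => X i t ⬝ᵥ δ) + Γ * B * Λᵀ + Eperp) := by
    ext i t
    have h : ∫ w, (L + ε w - Lhat w) i t ∂μ = L i t - ∫ w, Lhat w i t ∂μ := by
      have hY : Integrable (fun w => L i t + ε w i t) μ := (integrable_const _).add (hεint i t)
      refine (integral_sub hY (hLint i t)).trans (congrArg (· - ∫ w, Lhat w i t ∂μ) ?_)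
      refine (integral_add (integrable_const _) (hεint i t)).trans ?_
      rw [hεmean]
      simp
    simp only [Matrix.of_apply, Matrix.neg_apply, Matrix.add_apply]
    rw [h, ← hLhatMean, neg_sub]
  simp only [tauTROP_sub_eq_frobInner]
  rw [integral_frobInner hA, hmean, frobInner_neg_left, frobInner_add_left, frobInner_add_left,
    frobInner_dotProduct, frobInner_mul_mul_transpose_Mmat]
  ring
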